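/- Let P ∈ ℝ^{N×N} be symmetric positive definite, ρ ∈ (0,1), σ ≥ 0, L > 0. For each k = 1,…,K let f^k : ℝ^d → ℝ be convex, differentiable, and L-smooth with ∇f^k(x^{k,⋆}) = 0, let x_j^k ∈ ℝ^d for j = 1,…,n, and let z^k, z^{k,⋆} ∈ ℝ^N satisfy: (i) ‖z^{k+1} − z^{k,⋆}‖_P ≤ ρ·‖z^k − z^{k,⋆}‖_P for all k ≥ 1; (ii) ‖z^{k,⋆} − z^{k−1,⋆}‖_P ≤ σ for all k ≥ 2; (iii) ‖x̲^k − x̲^{k,⋆}‖ ≤ ‖z^{k+1} − z^{k,⋆}‖ with x̲^k := (x_1^k,…,x_n^k) and x̲^{k,⋆} := (x^{k,⋆},…,x^{k,⋆}) in ℝ^{nd}; (iv) ‖z^1 − z^{1,⋆}‖_P ≤ σ/(1 − ρ). Then the dynamic regret satisfies Reg^K := (1/n)·Σ_{j=1}^n Σ_{k=1}^K (f^k(x_j^k) − f^k(x^{k,⋆})) ≤ (Lσρ²/(λ_min(P)·(1 − ρ)²)) · ( ‖z^1 − z^{1,⋆}‖_P + W_K ), where W_K := Σ_{k=2}^K ‖z^{k,⋆}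 − z^{k−1,⋆}‖_P. -/

import Mathlib

open Matrix Finset

/-- The `P`-norm `‖v‖_P = √(vᵀ P v)`. -/
noncomputable def Pnorm {ι : Type*} [Fintype ι] (P : Matrix ι ι ℝ) (v : ι → ℝ) : ℝ :=
  Real.sqrt (v ⬝ᵥ P.mulVec v)

/-- The Euclidean norm of a finitely supported real vector. -/
noncomputable def vnorm {ι : Type*} [Fintype ι] (v : ι → ℝ) : ℝ :=
  Real.sqrt (v ⬝ᵥ v)

/-- Smallest eigenvalue of a hermitian (real symmetric) matrix. -/
noncomputable def lamMin {ι : Type*} [Fintype ι] [DecidableEq ι]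
    (P : Matrix ι ι ℝ) (hP : P.IsHermitian) : ℝ := ⨅ i, hP.eigenvalues i

/-- Largest eigenvalue of a hermitian (real symmetric) matrix. -/
noncomputable def lamMax {ι : Type*} [Fintype ι] [DecidableEq ι]
    (P : Matrix ι ι ℝ) (hP : P.IsHermitian) : ℝ := ⨆ i, hP.eigenvalues i

/-- First-order condition for convexity at a point where the gradient exists. -/
lemma ConvexOn.sub_le_inner_gradient {E : Type*} [NormedAddCommGroup E] [InnerProductSpace ℝ E]
    [CompleteSpace E] {f : E → ℝ} (hf : ConvexOn ℝ Set.univ f) {x : E}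
    (hd : DifferentiableAt ℝ f x) (y : E) :
    f x - f y ≤ inner ℝ (gradient f x) (x - y) := by
  have hline : HasDerivAt (fun t : ℝ => f (AffineMap.lineMap x y t))
      (inner ℝ (gradient f x) (y - x)) 0 := by
    have hg : HasFDerivAt f (InnerProductSpace.toDual ℝ E (gradient f x))
        (AffineMap.lineMap x y (0 : ℝ)) := by
      simpa using hd.hasGradientAt.hasFDerivAt
    simpa [Function.comp_def] using! hg.comp_hasDerivAt (0 : ℝ) AffineMap.hasDerivAt_lineMap
  have hconv : ConvexOn ℝ Set.univ (fun t : ℝ => f (AffineMap.lineMap x y t)) :=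
    hf.comp_affineMap (AffineMap.lineMap x y)
  have h := hconv.le_slope_of_hasDerivAt (Set.mem_univ 0) (Set.mem_univ 1) one_pos hline
  have hneg : inner ℝ (gradient f x) (x - y) = -inner ℝ (gradient f x) (y - x) := by
    rw [← inner_neg_right, neg_sub]
  simp only [slope_def_field, AffineMap.lineMap_apply_one, AffineMap.lineMap_apply_zero, sub_zero,
    div_one] at h
  linarith

/-- A convex function with `L`-Lipschitz gradient exceeds its value at a critical point `y`
by at most `L * ‖x - y‖ ^ 2`. -/
lemma ConvexOn.sub_le_of_gradient_eq_zero {E : Type*} [NormedAddCommGroup E]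
    [InnerProductSpace ℝ E] [CompleteSpace E] {f : E → ℝ} (hf : ConvexOn ℝ Set.univ f) {L : ℝ}
    {x y : E} (hd : DifferentiableAt ℝ f x)
    (hL : ‖gradient f x - gradient f y‖ ≤ L * ‖x - y‖) (hy : gradient f y = 0) :
    f x - f y ≤ L * ‖x - y‖ ^ 2 := by
  rw [hy, sub_zero] at hL
  calc f x - f y ≤ inner ℝ (gradient f x) (x - y) := hf.sub_le_inner_gradient hd y
    _ ≤ ‖gradient f x‖ * ‖x - y‖ := real_inner_le_norm _ _
    _ ≤ L * ‖x - y‖ * ‖x - y‖ := by gcongr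
    _ = L * ‖x - y‖ ^ 2 := by ring

lemma Pnorm_nonneg {ι : Type*} [Fintype ι] (P : Matrix ι ι ℝ) (v : ι → ℝ) : 0 ≤ Pnorm P v :=
  Real.sqrt_nonneg _

lemma Pnorm_neg {ι : Type*} [Fintype ι] (P : Matrix ι ι ℝ) (v : ι → ℝ) :
    Pnorm P (-v) = Pnorm P v := by
  simp [Pnorm, Matrix.mulVec_neg]

lemma Pnorm_sq {ι : Type*} [Fintype ι] {P : Matrix ι ι ℝ} (hP : P.PosSemidef) (v : ι → ℝ) :
    Pnorm P v ^ 2 = v ⬝ᵥ P.mulVec v :=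
  Real.sq_sqrt (by simpa using hP.dotProduct_mulVec_nonneg v)

lemma vnorm_sq {ι : Type*} [Fintype ι] (v : ι → ℝ) : vnorm v ^ 2 = v ⬝ᵥ v :=
  Real.sq_sqrt (by simpa using dotProduct_star_self_nonneg v)

open scoped MatrixOrder in
lemma Pnorm_add_le {ι : Type*} [Fintype ι] {P : Matrix ι ι ℝ} (hP : P.PosSemidef)
    (u v : ι → ℝ) : Pnorm P (u + v) ≤ Pnorm P u + Pnorm P v := by
  classical
  obtain ⟨B, rfl⟩ := CStarAlgebra.nonneg_iff_eq_star_mul_self.mp hP.nonneg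
  have hnorm (w : ι → ℝ) : Pnorm (star B * B) w = ‖WithLp.toLp 2 (B.mulVec w)‖ := by
    rw [Pnorm, EuclideanSpace.norm_eq, ← Matrix.mulVec_mulVec, Matrix.dotProduct_mulVec,
      Matrix.star_eq_conjTranspose, Matrix.conjTranspose_eq_transpose_of_trivial,
      Matrix.vecMul_transpose]
    simp [dotProduct, sq]
  simpa only [hnorm, Matrix.mulVec_add, WithLp.toLp_add] using norm_add_le _ _

open scoped MatrixOrder in
lemma lamMin_mul_dotProduct_le {ι : Type*} [Fintype ι] [DecidableEq ι] {P : Matrix ι ι ℝ}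
    (hP : P.IsHermitian) (v : ι → ℝ) : lamMin P hP * (v ⬝ᵥ v) ≤ v ⬝ᵥ P.mulVec v := by
  have hle : algebraMap ℝ (Matrix ι ι ℝ) (lamMin P hP) ≤ P := by
    refine algebraMap_le_of_le_spectrum (fun r hr => ?_) hP.isSelfAdjoint
    obtain ⟨i, rfl⟩ := hP.spectrum_real_eq_range_eigenvalues ▸ hr
    exact ciInf_le (Set.finite_range _).bddBelow i
  have h := (Matrix.le_iff.1 hle).dotProduct_mulVec_nonneg v
  simp only [star_trivial, Matrix.sub_mulVec, dotProduct_sub, Algebra.algebraMap_eq_smul_one,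
    Matrix.smul_mulVec, Matrix.one_mulVec, dotProduct_smul, smul_eq_mul] at h
  linarith

lemma lamMin_nonneg {ι : Type*} [Fintype ι] [DecidableEq ι] {P : Matrix ι ι ℝ}
    (hP : P.PosSemidef) : 0 ≤ lamMin P hP.1 :=
  Real.iInf_nonneg hP.eigenvalues_nonneg

lemma lamMin_pos {ι : Type*} [Fintype ι] [DecidableEq ι] [Nonempty ι] {P : Matrix ι ι ℝ}
    (hP : P.PosDef) : 0 < lamMin P hP.1 := by
  obtain ⟨i, hi⟩ := exists_eq_ciInf_of_finite (f := hP.1.eigenvalues)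
  rw [lamMin, ← hi]
  exact hP.eigenvalues_pos i

lemma vnorm_sq_le_Pnorm_sq_div {ι : Type*} [Fintype ι] [DecidableEq ι] {P : Matrix ι ι ℝ}
    (hP : P.PosDef) (v : ι → ℝ) : vnorm v ^ 2 ≤ Pnorm P v ^ 2 / lamMin P hP.1 := by
  rcases isEmpty_or_nonempty ι with _ | _
  · simp [vnorm, Pnorm]
  · rw [le_div_iff₀ (lamMin_pos hP), vnorm_sq, Pnorm_sq hP.posSemidef, mul_comm]
    exact lamMin_mul_dotProduct_le hP.1 v

/-- A sequence satisfying the perturbed contraction `a (k + 1) ≤ ρ * a k + w (k + 1)` with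
`w ≤ σ` stays below the fixed point `σ / (1 - ρ)` once it starts there. -/
lemma le_div_of_perturbed_contraction {a w : ℕ → ℝ} {ρ σ : ℝ} (hρ0 : 0 ≤ ρ) (hρ1 : ρ < 1)
    (hstep : ∀ k ≥ 1, a (k + 1) ≤ ρ * a k + w (k + 1)) (hw : ∀ k ≥ 2, w k ≤ σ)
    (hinit : a 1 ≤ σ / (1 - ρ)) {k : ℕ} (hk : 1 ≤ k) : a k ≤ σ / (1 - ρ) := by
  induction k, hk using Nat.le_induction with
  | base => exact hinit
  | succ k hk ih =>
    have hfix : ρ * (σ / (1 - ρ)) + σ = σ / (1 - ρ) := by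
      have : 1 - ρ ≠ 0 := by linarith
      field_simp
      ring
    linarith [hstep k hk, hw (k + 1) (by omega), mul_le_mul_of_nonneg_left ih hρ0]

/-- Total size of a nonnegative sequence satisfying a perturbed contraction. -/
lemma sum_Icc_le_div_of_perturbed_contraction {a w : ℕ → ℝ} {ρ : ℝ} (hρ0 : 0 ≤ ρ) (hρ1 : ρ < 1)
    (ha : ∀ k, 0 ≤ a k) (hstep : ∀ k ≥ 1, a (k + 1) ≤ ρ * a k + w (k + 1)) (K : ℕ) :
    ∑ k ∈ Finset.Icc 1 K, a k ≤ (a 1 + ∑ k ∈ Finset.Icc 2 K, w k) / (1 - ρ) := by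
  rw [le_div_iff₀ (by linarith)]
  rcases Nat.eq_zero_or_pos K with rfl | hK
  · simpa using ha 1
  suffices h : (∑ k ∈ Finset.Icc 1 K, a k) * (1 - ρ) + ρ * a K ≤
      a 1 + ∑ k ∈ Finset.Icc 2 K, w k by
    linarith [mul_nonneg hρ0 (ha K)]
  induction K, hK using Nat.le_induction with
  | base => simp; linarith
  | succ K hK ih =>
    rw [Finset.sum_Icc_succ_top (by omega), Finset.sum_Icc_succ_top (by omega)]
    linarith [hstep K hK]

/-- **Theorem 3.** Under convexity, `L`-smoothness, `∇f^k(x^{k,⋆}) = 0`, the contraction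
(i), bounded variations (ii), the sub-block bound (iii), and the initial condition (iv),
the dynamic regret satisfies
`Reg^K ≤ (Lσρ²/(λ_min(P)(1-ρ)²))·(‖z^1 - z^{1,⋆}‖_P + W_K)`. -/
theorem ggt_dynamic_regret_linear {N d n : ℕ}
    (P : Matrix (Fin N) (Fin N) ℝ) (hP : P.PosDef)
    (ρ σ L : ℝ) (hρ0 : 0 < ρ) (hρ1 : ρ < 1) (hσ : 0 ≤ σ) (hL : 0 < L) (K : ℕ)
    (f : ℕ → EuclideanSpace ℝ (Fin d) → ℝ)
    (xs : ℕ → EuclideanSpace ℝ (Fin d))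
    (x : ℕ → Fin n → EuclideanSpace ℝ (Fin d))
    (hconv : ∀ k, ConvexOn ℝ Set.univ (f k))
    (hdiff : ∀ k, Differentiable ℝ (f k))
    (hsmooth : ∀ k, ∀ w v : EuclideanSpace ℝ (Fin d),
      ‖gradient (f k) w - gradient (f k) v‖ ≤ L * ‖w - v‖)
    (hgrad0 : ∀ k, gradient (f k) (xs k) = 0)
    (z zs : ℕ → Fin N → ℝ)
    (hcontract : ∀ k ≥ 1, Pnorm P (z (k + 1) - zs k) ≤ ρ * Pnorm P (z k - zs k))
    (hvar : ∀ k ≥ 2, Pnorm P (zs k - zs (k - 1)) ≤ σ)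
    (hsub : ∀ k, Real.sqrt (∑ j : Fin n, ‖x k j - xs k‖ ^ 2) ≤
      vnorm (z (k + 1) - zs k))
    (hinit : Pnorm P (z 1 - zs 1) ≤ σ / (1 - ρ)) :
    (1 / (n : ℝ)) * ∑ j : Fin n, ∑ k ∈ Finset.Icc 1 K, (f k (x k j) - f k (xs k)) ≤
      L * σ * ρ ^ 2 / (lamMin P hP.1 * (1 - ρ) ^ 2) *
        (Pnorm P (z 1 - zs 1)
          + ∑ k ∈ Finset.Icc 2 K, Pnorm P (zs k - zs (k - 1))) := by
  have hρ : 0 < 1 - ρ := by linarith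
  have hlam := lamMin_nonneg hP.posSemidef
  set lam := lamMin P hP.1
  set a : ℕ → ℝ := fun k => Pnorm P (z k - zs k)
  set w : ℕ → ℝ := fun k => Pnorm P (zs k - zs (k - 1)) with hw_def
  have ha (k : ℕ) : 0 ≤ a k := Pnorm_nonneg _ _
  have hstep (k : ℕ) (hk : k ≥ 1) : a (k + 1) ≤ ρ * a k + w (k + 1) := by
    have htri := Pnorm_add_le hP.posSemidef (z (k + 1) - zs k) (zs k - zs (k + 1))
    have hsymm : Pnorm P (zs k - zs (k + 1)) = w (k + 1) := by
      simp only [hw_def, Nat.add_sub_cancel]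
      rw [← neg_sub, Pnorm_neg]
    rw [sub_add_sub_cancel, hsymm] at htri
    exact htri.trans (by gcongr; exact hcontract k hk)
  have hbound (k : ℕ) (hk : 1 ≤ k) : a k ≤ σ / (1 - ρ) :=
    le_div_of_perturbed_contraction hρ0.le hρ1 hstep hvar hinit hk
  have hsum := sum_Icc_le_div_of_perturbed_contraction hρ0.le hρ1 ha hstep K
  have hW : 0 ≤ a 1 + ∑ k ∈ Finset.Icc 2 K, w k :=
    add_nonneg (ha 1) (Finset.sum_nonneg fun k _ => Pnorm_nonneg _ _)
  have hround (k : ℕ) (hk : k ∈ Finset.Icc 1 K) :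
      ∑ j : Fin n, (f k (x k j) - f k (xs k)) ≤ L * ρ ^ 2 / lam * (σ / (1 - ρ)) * a k := by
    have hk1 := (Finset.mem_Icc.1 hk).1
    calc ∑ j : Fin n, (f k (x k j) - f k (xs k))
        ≤ ∑ j : Fin n, L * ‖x k j - xs k‖ ^ 2 := Finset.sum_le_sum fun j _ =>
          (hconv k).sub_le_of_gradient_eq_zero (hdiff k _) (hsmooth k _ _) (hgrad0 k)
      _ = L * ∑ j : Fin n, ‖x k j - xs k‖ ^ 2 := by rw [Finset.mul_sum]
      _ ≤ L * vnorm (z (k + 1) - zs k) ^ 2 := by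
          gcongr
          exact (Real.sqrt_le_left (Real.sqrt_nonneg _)).1 (hsub k)
      _ ≤ L * (Pnorm P (z (k + 1) - zs k) ^ 2 / lam) := by
          gcongr
          exact vnorm_sq_le_Pnorm_sq_div hP _
      _ ≤ L * ((ρ * a k) ^ 2 / lam) := by
          gcongr
          · exact Pnorm_nonneg _ _
          · exact hcontract k hk1
      _ = L * ρ ^ 2 / lam * a k * a k := by ring
      _ ≤ L * ρ ^ 2 / lam * (σ / (1 - ρ)) * a k := by
          gcongr
          · exact ha k
          · exact hbound k hk1
  have htotal : ∑ j : Fin n, ∑ k ∈ Finset.Icc 1 K, (f k (x k j) - f k (xs k)) ≤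
      L * σ * ρ ^ 2 / (lam * (1 - ρ) ^ 2) * (a 1 + ∑ k ∈ Finset.Icc 2 K, w k) := by
    calc _ = ∑ k ∈ Finset.Icc 1 K, ∑ j : Fin n, (f k (x k j) - f k (xs k)) := Finset.sum_comm
      _ ≤ ∑ k ∈ Finset.Icc 1 K, L * ρ ^ 2 / lam * (σ / (1 - ρ)) * a k := Finset.sum_le_sum hround
      _ = L * ρ ^ 2 / lam * (σ / (1 - ρ)) * ∑ k ∈ Finset.Icc 1 K, a k := by rw [Finset.mul_sum]
      _ ≤ L * ρ ^ 2 / lam * (σ / (1 - ρ)) *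
          ((a 1 + ∑ k ∈ Finset.Icc 2 K, w k) / (1 - ρ)) := by gcongr
      _ = _ := by
          rw [div_mul_div_comm, div_mul_div_comm, div_mul_eq_mul_div]
          congr 1 <;> ring
  calc _ ≤ 1 / (n : ℝ) *
        (L * σ * ρ ^ 2 / (lam * (1 - ρ) ^ 2) * (a 1 + ∑ k ∈ Finset.Icc 2 K, w k)) := by gcongr
    _ ≤ _ := mul_le_of_le_one_left (by positivity) (by simpa using Nat.cast_inv_le_one n)
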